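/- arXiv:0904.3045 — 3 statements merged into one kernel-verified Lean document; each statement's English description precedes it below -/
import Mathlib

section
/- Over a right coherent ring R, a module M is n-strongly Gorenstein flat if and only if there exists an exact sequence 0 → M →^{h_n} F_{n−1} → ⋯ → F₀ →^{h_0} M → 0 in which each F_i has finite flat dimension such that ⊕_{i=1}^{n} Im(h_i) is Gorenstein flat. -/
open CategoryTheory DirectSum

universe u

section Defs

variable (R : Type u) [Ring R]

/-- The ℤ-indexed complex `⋯ → P (i+1) → P i → ⋯` is exact, and it is the `n`-periodic
unrolling of an exact sequence `0 → M → P_{n-1} → ⋯ → P_0 → M → 0`; that is, `M` is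
(isomorphic to) the syzygy of the complex at every position divisible by `n`. -/
def IsPeriodicExact (n : ℕ) (M : Type u) [AddCommGroup M] [Module R M]
    (P : ℤ → ModuleCat.{u} R) (d : ∀ i : ℤ, P (i + 1) →ₗ[R] P i) : Prop :=
  (∀ i : ℤ, Function.Exact (d (i + 1)) (d i)) ∧
  ∀ k : ℤ, Nonempty (M ≃ₗ[R] LinearMap.range (d ((n : ℤ) * k)))

/-- The complex stays exact after applying `Hom_R(-, Q)` for every projective `Q`. -/
def IsHomExact (P : ℤ → ModuleCat.{u} R) (d : ∀ i : ℤ, P (i + 1) →ₗ[R] P i) : Prop :=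
  ∀ (Q : ModuleCat.{u} R), Module.Projective R Q →
    ∀ i : ℤ, Function.Exact (fun g : P i →ₗ[R] Q => g.comp (d i))
      (fun g : P (i + 1) →ₗ[R] Q => g.comp (d (i + 1)))

/-- `M` is `n`-strongly Gorenstein projective: there is an exact sequence
`0 → M → P_{n-1} → ⋯ → P_0 → M → 0` with all `P i` projective which stays exact
under `Hom_R(-, Q)` for every projective `Q` (encoded via its periodic unrolling). -/
def IsNSGProjective (n : ℕ) (M : Type u) [AddCommGroup M] [Module R M] : Prop :=
  ∃ (P : ℤ → ModuleCat.{u} R) (d : ∀ i : ℤ, P (i + 1) →ₗ[R] P i),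
    (∀ i, Module.Projective R (P i)) ∧ IsPeriodicExact R n M P d ∧ IsHomExact R P d

/-- `M` is Gorenstein projective: it is a syzygy of a totally acyclic complex of
projectives. -/
def IsGProjective (M : Type u) [AddCommGroup M] [Module R M] : Prop :=
  ∃ (P : ℤ → ModuleCat.{u} R) (d : ∀ i : ℤ, P (i + 1) →ₗ[R] P i),
    (∀ i, Module.Projective R (P i)) ∧ (∀ i : ℤ, Function.Exact (d (i + 1)) (d i)) ∧
    IsHomExact R P d ∧ Nonempty (M ≃ₗ[R] LinearMap.range (d 0))

/-- The projective dimension of `M` is at most `m`. -/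
def projDimLE : ℕ → ModuleCat.{u} R → Prop
  | 0, M => Module.Projective R M
  | m + 1, M => ∃ (F : ModuleCat.{u} R) (f : F →ₗ[R] M), Module.Projective R F ∧
      Function.Surjective f ∧ projDimLE m (ModuleCat.of R (LinearMap.ker f))

end Defs

section FlatDefs

variable (R : Type u) [CommRing R]

/-- The complex stays exact after applying `I ⊗_R -` for every injective module `I`. -/
def IsTensorExact (P : ℤ → ModuleCat.{u} R) (d : ∀ i : ℤ, P (i + 1) →ₗ[R] P i) : Prop :=
  ∀ (I : ModuleCat.{u} R), Module.Injective R I →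
    ∀ i : ℤ, Function.Exact (LinearMap.lTensor I (d (i + 1))) (LinearMap.lTensor I (d i))

/-- `M` is `n`-strongly Gorenstein flat: there is an exact sequence
`0 → M → F_{n-1} → ⋯ → F_0 → M → 0` with all `F i` flat which stays exact under
`I ⊗_R -` for every injective `I` (encoded via its periodic unrolling). -/
def IsNSGFlat (n : ℕ) (M : Type u) [AddCommGroup M] [Module R M] : Prop :=
  ∃ (P : ℤ → ModuleCat.{u} R) (d : ∀ i : ℤ, P (i + 1) →ₗ[R] P i),
    (∀ i, Module.Flat R (P i)) ∧ IsPeriodicExact R n M P d ∧ IsTensorExact R P d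

/-- `M` is Gorenstein flat: it is a syzygy of an exact complex of flat modules which
stays exact under `I ⊗_R -` for every injective `I`. -/
def IsGFlat (M : Type u) [AddCommGroup M] [Module R M] : Prop :=
  ∃ (P : ℤ → ModuleCat.{u} R) (d : ∀ i : ℤ, P (i + 1) →ₗ[R] P i),
    (∀ i, Module.Flat R (P i)) ∧ (∀ i : ℤ, Function.Exact (d (i + 1)) (d i)) ∧
    IsTensorExact R P d ∧ Nonempty (M ≃ₗ[R] LinearMap.range (d 0))

/-- The flat dimension of `M` is at most `m`. -/
def flatDimLE : ℕ → ModuleCat.{u} R → Prop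
  | 0, M => Module.Flat R M
  | m + 1, M => ∃ (F : ModuleCat.{u} R) (f : F →ₗ[R] M), Module.Flat R F ∧
      Function.Surjective f ∧ flatDimLE m (ModuleCat.of R (LinearMap.ker f))

/-- The complex stays exact after applying `Hom_R(X, -)` for every injective `X`. -/
def IsCohomExact (E : ℤ → ModuleCat.{u} R) (d : ∀ i : ℤ, E (i + 1) →ₗ[R] E i) : Prop :=
  ∀ (X : ModuleCat.{u} R), Module.Injective R X →
    ∀ i : ℤ, Function.Exact (fun g : X →ₗ[R] E (i + 1 + 1) => (d (i + 1)).comp g)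
      (fun g : X →ₗ[R] E (i + 1) => (d i).comp g)

/-- `M` is `n`-strongly Gorenstein injective: there is an exact sequence
`0 → M → E^{n-1} → ⋯ → E^0 → M → 0` with all `E i` injective which stays exact under
`Hom_R(X, -)` for every injective `X` (encoded via its periodic unrolling). -/
def IsNSGInjective (n : ℕ) (M : Type u) [AddCommGroup M] [Module R M] : Prop :=
  ∃ (E : ℤ → ModuleCat.{u} R) (d : ∀ i : ℤ, E (i + 1) →ₗ[R] E i),
    (∀ i, Module.Injective R (E i)) ∧ IsPeriodicExact R n M E d ∧ IsCohomExact R E d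

end FlatDefs

section Helpers

open Abelian

variable {R : Type u} [CommRing R]

/-- Vanishing of `Ext^j(X, Y)`. -/
def EV (R : Type u) [CommRing R] (X Y : Type u) [AddCommGroup X] [Module R X] [AddCommGroup Y]
    [Module R Y] (j : ℕ) : Prop :=
  ∀ e : Ext.{u} (ModuleCat.of R X) (ModuleCat.of R Y) j, e = 0

variable {A B C Y : Type u} [AddCommGroup A] [Module R A] [AddCommGroup B] [Module R B]
  [AddCommGroup C] [Module R C] [AddCommGroup Y] [Module R Y]

lemma sesShortExact (f : A →ₗ[R] B) (g : B →ₗ[R] C) (hf : Function.Injective f)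
    (hg : Function.Surjective g) (h : Function.Exact f g) :
    (ModuleCat.shortComplexOfCompEqZero f g h.linearMap_comp_eq_zero).ShortExact where
  exact := (ShortComplex.ShortExact.moduleCat_exact_iff_function_exact _).mpr h
  mono_f := (ModuleCat.mono_iff_injective _).mpr hf
  epi_g := (ModuleCat.epi_iff_surjective _).mpr hg

lemma EV.third (f : A →ₗ[R] B) (g : B →ₗ[R] C) (hf : Function.Injective f)
    (hg : Function.Surjective g) (h : Function.Exact f g) {j : ℕ}
    (hA : EV R A Y j) (hB : EV R B Y (j + 1)) : EV R C Y (j + 1) := by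
  intro e
  obtain ⟨x, rfl⟩ := Ext.contravariant_sequence_exact₃ (sesShortExact f g hf hg h)
    (ModuleCat.of R Y) e (hB _) (add_comm 1 j)
  rw [hA x]; exact Ext.comp_zero ..

lemma EV.middle (f : A →ₗ[R] B) (g : B →ₗ[R] C) (hf : Function.Injective f)
    (hg : Function.Surjective g) (h : Function.Exact f g) {j : ℕ}
    (hA : EV R A Y j) (hC : EV R C Y j) : EV R B Y j := by
  intro e
  obtain ⟨x, rfl⟩ := Ext.contravariant_sequence_exact₂ (sesShortExact f g hf hg h)
    (ModuleCat.of R Y) e (hA _)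
  rw [hC x]; exact Ext.comp_zero ..

lemma EV.co_third (f : A →ₗ[R] B) (g : B →ₗ[R] C) (hf : Function.Injective f)
    (hg : Function.Surjective g) (h : Function.Exact f g) {j : ℕ}
    (hB : EV R Y B j) (hA : EV R Y A (j + 1)) : EV R Y C j := by
  intro e
  obtain ⟨x, rfl⟩ := Ext.covariant_sequence_exact₃ (ModuleCat.of R Y) (sesShortExact f g hf hg h)
    e rfl (hA _)
  rw [hB x]; exact Ext.zero_comp ..

lemma EV.co_first (f : A →ₗ[R] B) (g : B →ₗ[R] C) (hf : Function.Injective f)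
    (hg : Function.Surjective g) (h : Function.Exact f g) {j : ℕ}
    (hC : EV R Y C j) (hB : EV R Y B (j + 1)) : EV R Y A (j + 1) := by
  intro e
  obtain ⟨x, rfl⟩ := Ext.covariant_sequence_exact₁ (ModuleCat.of R Y) (sesShortExact f g hf hg h)
    e (hB _) rfl
  rw [hC x]; exact Ext.zero_comp ..

lemma EV.retract (i : A →ₗ[R] B) (r : B →ₗ[R] A) (h : r.comp i = LinearMap.id) {j : ℕ}
    (hB : EV R B Y j) : EV R A Y j := by
  intro e
  have h1 : ModuleCat.ofHom i ≫ ModuleCat.ofHom r = 𝟙 _ := by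
    rw [← ModuleCat.ofHom_comp, h]; rfl
  have : (Ext.mk₀ (ModuleCat.ofHom i)).comp
      ((Ext.mk₀ (ModuleCat.ofHom r)).comp e (zero_add j)) (zero_add j) = e := by
    rw [Ext.mk₀_comp_mk₀_assoc, h1, Ext.mk₀_id_comp]
  rw [← this, hB ((Ext.mk₀ (ModuleCat.ofHom r)).comp e (zero_add j))]
  exact Ext.comp_zero ..

lemma EV.of_projective [Module.Projective R A] (j : ℕ) : EV R A Y (j + 1) := by
  have : Projective (ModuleCat.of R A) := ModuleCat.projective_of_categoryTheory_projective _
  exact fun e => Ext.eq_zero_of_projective e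

lemma EV.of_injective [Module.Injective R Y] (j : ℕ) : EV R A Y (j + 1) := by
  have : Injective (ModuleCat.of R Y) := Module.injective_object_of_injective_module R Y
  exact fun e => Ext.eq_zero_of_injective e

lemma EV.lift (f : A →ₗ[R] B) (g : B →ₗ[R] C) (hf : Function.Injective f)
    (hg : Function.Surjective g) (h : Function.Exact f g) (hC : EV R C Y 1) (φ : A →ₗ[R] Y) :
    ∃ ψ : B →ₗ[R] Y, ψ.comp f = φ := by
  obtain ⟨x, hx⟩ := Ext.contravariant_sequence_exact₁ (sesShortExact f g hf hg h)
    (ModuleCat.of R Y) (Ext.mk₀ (ModuleCat.ofHom φ)) (n₁ := 1) rfl (hC _)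
  obtain ⟨ψ, rfl⟩ := (Ext.mk₀_bijective _ _).2 x
  rw [Ext.mk₀_comp_mk₀] at hx
  have := (Ext.mk₀_bijective _ _).1 hx
  exact ⟨ψ.hom, congrArg ModuleCat.Hom.hom this⟩

lemma EV.of_lift (f : A →ₗ[R] B) (g : B →ₗ[R] C) (hf : Function.Injective f)
    (hg : Function.Surjective g) (h : Function.Exact f g) (hB : EV R B Y 1)
    (H : ∀ φ : A →ₗ[R] Y, ∃ ψ : B →ₗ[R] Y, ψ.comp f = φ) : EV R C Y 1 := by
  intro e
  obtain ⟨x, rfl⟩ := Ext.contravariant_sequence_exact₃ (sesShortExact f g hf hg h)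
    (ModuleCat.of R Y) e (hB _) (n₀ := 0) rfl
  obtain ⟨φ, rfl⟩ := (Ext.mk₀_bijective _ _).2 x
  obtain ⟨ψ, hψ⟩ := H φ.hom
  have : φ = (ModuleCat.ofHom f) ≫ (ModuleCat.ofHom ψ) := by
    ext x; exact (LinearMap.congr_fun hψ x).symm
  rw [this]
  rw [← Ext.mk₀_comp_mk₀]
  exact ShortComplex.ShortExact.extClass_comp_assoc (sesShortExact f g hf hg h) _

lemma EV.co_lift (f : A →ₗ[R] B) (g : B →ₗ[R] C) (hf : Function.Injective f)
    (hg : Function.Surjective g) (h : Function.Exact f g) (hA : EV R Y A 1) (φ : Y →ₗ[R] C) :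
    ∃ ψ : Y →ₗ[R] B, g.comp ψ = φ := by
  obtain ⟨x, hx⟩ := Ext.covariant_sequence_exact₃ (ModuleCat.of R Y) (sesShortExact f g hf hg h)
    (Ext.mk₀ (ModuleCat.ofHom φ)) (n₁ := 1) rfl (hA _)
  obtain ⟨ψ, rfl⟩ := (Ext.mk₀_bijective _ _).2 x
  rw [Ext.mk₀_comp_mk₀] at hx
  have := (Ext.mk₀_bijective _ _).1 hx
  exact ⟨ψ.hom, congrArg ModuleCat.Hom.hom this⟩

/-- Exactness of the dual sequence. -/
lemma dual_exact (f : A →ₗ[R] B) (g : B →ₗ[R] C)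
    (hg : Function.Surjective g) (h : Function.Exact f g) :
    Function.Exact (CharacterModule.dual g) (CharacterModule.dual f) := by
  intro c
  constructor
  · intro hc
    have hc' : ∀ a, c (f a) = 0 := fun a => DFunLike.congr_fun hc a
    have hk : ∀ x y, g x = g y → c x = c y := by
      intro x y hxy
      obtain ⟨a, ha⟩ := (h (x - y)).1 (by rw [map_sub, hxy, sub_self])
      have := hc' a
      rw [ha, map_sub] at this
      exact sub_eq_zero.1 this
    let s := Function.surjInv hg
    have hs : ∀ x, g (s x) = x := Function.surjInv_eq hg
    refine ⟨(AddMonoidHom.mk' (fun x => c (s x)) (fun x y => ?_) : C →+ AddCircle (1 : ℚ)), ?_⟩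
    · rw [← map_add c]
      exact hk _ _ (by simp [hs])
    · ext x
      exact hk _ _ (hs _)
  · rintro ⟨c, rfl⟩
    ext a
    change c (g (f a)) = 0
    rw [h.apply_apply_eq_zero, map_zero]

lemma exists_free_cover (N : Type u) [AddCommGroup N] [Module R N] :
    ∃ (F : ModuleCat.{u} R) (g : F →ₗ[R] N), Module.Projective R F ∧ Function.Surjective g :=
  ⟨ModuleCat.of R (N →₀ R), Finsupp.linearCombination R id,
    (inferInstance : Module.Projective R (N →₀ R)), Finsupp.linearCombination_id_surjective R N⟩

lemma EV.of_flat [Module.Flat R A] (j : ℕ) : ∀ (N : Type u) [AddCommGroup N] [Module R N],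
    EV R A (CharacterModule N) (j + 1) := by
  induction j with
  | zero =>
    intro N _ _
    obtain ⟨F, g, hF, hg⟩ := exists_free_cover (R := R) A
    have hex : Function.Exact (LinearMap.ker g).subtype g := g.exact_subtype_ker_map
    refine EV.of_lift (LinearMap.ker g).subtype g (Submodule.subtype_injective _) hg hex
      (EV.of_projective 0) ?_
    have := LinearMap.lTensor_injective_of_exact_of_flat g hg _ (Submodule.subtype_injective _)
      hex N
    rw [LinearMap.lTensor_inj_iff_rTensor_inj, rTensor_injective_iff_lcomp_surjective] at this
    exact this
  | succ j ih =>
    intro N _ _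
    obtain ⟨F, g, hF, hg⟩ := exists_free_cover (R := R) N
    have hex : Function.Exact (LinearMap.ker g).subtype g := g.exact_subtype_ker_map
    have : Module.Injective R (CharacterModule F) :=
      Module.Flat.iff_characterModule_injective.1 inferInstance
    exact EV.co_first (CharacterModule.dual g) (CharacterModule.dual (LinearMap.ker g).subtype)
      (CharacterModule.dual_injective_of_surjective _ hg)
      (CharacterModule.dual_surjective_of_injective _ (Submodule.subtype_injective _))
      (dual_exact _ _ hg hex) (ih _) (EV.of_injective _)

lemma flat_of_EV (H : ∀ (N : Type u) [AddCommGroup N] [Module R N],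
    EV R A (CharacterModule N) 1) : Module.Flat R A := by
  rw [Module.Flat.iff_rTensor_preserves_injective_linearMap'.{u}]
  intro N N' _ _ _ _ f hf
  have hex : Function.Exact f (LinearMap.range f).mkQ := f.exact_map_mkQ_range
  have hs := Submodule.mkQ_surjective (LinearMap.range f)
  have key := EV.co_lift (Y := A) _ _ (CharacterModule.dual_injective_of_surjective _ hs)
    (CharacterModule.dual_surjective_of_injective _ hf) (dual_exact _ _ hs hex) (H _)
  rw [← LinearMap.lTensor_inj_iff_rTensor_inj]
  rw [← CharacterModule.dual_surjective_iff_injective]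
  intro c
  obtain ⟨ψ, hψ⟩ := key (CharacterModule.homEquiv.symm c)
  refine ⟨CharacterModule.homEquiv ψ, ?_⟩
  apply CharacterModule.homEquiv.symm.injective
  rw [← hψ]
  ext a n
  rfl

lemma EV.of_flatDim (m : ℕ) : ∀ (P : ModuleCat.{u} R), flatDimLE R m P → ∀ (j : ℕ),
    m ≤ j → ∀ (N : Type u) [AddCommGroup N] [Module R N], EV R P (CharacterModule N) (j + 1) := by
  induction m with
  | zero =>
    intro P hP j _ N _ _
    have : Module.Flat R P := hP
    exact EV.of_flat j N
  | succ m ih =>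
    rintro P ⟨F, f, hF, hf, hk⟩ j hj N _ _
    obtain ⟨j, rfl⟩ : ∃ k, j = k + 1 := ⟨j - 1, by omega⟩
    exact EV.third (LinearMap.ker f).subtype f (Submodule.subtype_injective _) hf
      f.exact_subtype_ker_map (ih _ hk j (by omega) N) (EV.of_flat _ N)

/-- Orthogonality to duals of injectives. -/
def GoodMod (R : Type u) [CommRing R] (X : Type u) [AddCommGroup X] [Module R X] : Prop :=
  ∀ (I : ModuleCat.{u} R), Module.Injective R I → ∀ j : ℕ, EV R X (CharacterModule I) (j + 1)

lemma flat_of_good (P : ModuleCat.{u} R) (hP : GoodMod R P) (hfd : ∃ m, flatDimLE R m P) :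
    Module.Flat R P := by
  obtain ⟨m, hm⟩ := hfd
  have key : ∀ k j : ℕ, m ≤ j + k → ∀ (N : Type u) [AddCommGroup N] [Module R N],
      EV R P (CharacterModule N) (j + 1) := by
    intro k
    induction k with
    | zero => intro j hj N _ _; exact EV.of_flatDim m P hm j hj N
    | succ k ih =>
      intro j hj N _ _
      let E : ModuleCat.{u} R := Injective.under (ModuleCat.of R N)
      let i : N →ₗ[R] E := (Injective.ι (ModuleCat.of R N)).hom
      have hi : Function.Injective i := (ModuleCat.mono_iff_injective _).1
        (inferInstance : Mono (Injective.ι (ModuleCat.of R N)))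
      have hE : Module.Injective R E := (Module.injective_iff_injective_object R E).2
        (inferInstance : Injective (Injective.under (ModuleCat.of R N)))
      have hs := Submodule.mkQ_surjective (LinearMap.range i)
      exact EV.co_third _ _ (CharacterModule.dual_injective_of_surjective _ hs)
        (CharacterModule.dual_surjective_of_injective _ hi) (dual_exact _ _ hs i.exact_map_mkQ_range)
        (hP E hE j) (ih (j + 1) (by omega) _)
  exact flat_of_EV (key m 0 (by omega))

/-- A short exact sequence with flat middle term, such that every map from the first term to the
dual of an injective module extends. -/
def Ses (R : Type u) [CommRing R] (A C : Type u) [AddCommGroup A] [Module R A]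
    [AddCommGroup C] [Module R C] : Prop :=
  ∃ (Q : ModuleCat.{u} R) (f : A →ₗ[R] Q) (g : Q →ₗ[R] C), Module.Flat R Q ∧
    Function.Injective f ∧ Function.Surjective g ∧ Function.Exact f g ∧
    ∀ (I : ModuleCat.{u} R), Module.Injective R I → ∀ φ : A →ₗ[R] CharacterModule I,
      ∃ ψ : Q →ₗ[R] CharacterModule I, ψ.comp f = φ

lemma lTensor_inj_iff_lift (f : A →ₗ[R] B) (I : Type u) [AddCommGroup I] [Module R I] :
    Function.Injective (f.lTensor I) ↔
      ∀ φ : A →ₗ[R] CharacterModule I, ∃ ψ : B →ₗ[R] CharacterModule I, ψ.comp f = φ := by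
  rw [LinearMap.lTensor_inj_iff_rTensor_inj, rTensor_injective_iff_lcomp_surjective]
  rfl

lemma Ses.congr {A' C' : Type u} [AddCommGroup A'] [Module R A'] [AddCommGroup C'] [Module R C']
    (h : Ses R A C) (eA : A' ≃ₗ[R] A) (eC : C ≃ₗ[R] C') : Ses R A' C' := by
  obtain ⟨Q, f, g, hQ, hf, hg, hex, hl⟩ := h
  refine ⟨Q, f.comp eA.toLinearMap, eC.toLinearMap.comp g, hQ, hf.comp eA.injective,
    eC.surjective.comp hg, ?_, ?_⟩
  · intro x
    have := hex x
    constructor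
    · intro hx
      obtain ⟨a, rfl⟩ := this.1 (by simpa using hx)
      exact ⟨eA.symm a, by simp⟩
    · rintro ⟨a, rfl⟩
      simp [hex.apply_apply_eq_zero]
  · intro I hI φ
    obtain ⟨ψ, hψ⟩ := hl I hI (φ.comp eA.symm.toLinearMap)
    refine ⟨ψ, ?_⟩
    ext1 a
    have := LinearMap.congr_fun hψ (eA a)
    simpa using this

lemma range_exact (P : ℤ → ModuleCat.{u} R) (d : ∀ i : ℤ, P (i + 1) →ₗ[R] P i)
    (hex : ∀ i : ℤ, Function.Exact (d (i + 1)) (d i)) (k : ℤ) :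
    Function.Exact (LinearMap.range (d (k + 1))).subtype (d k).rangeRestrict := by
  intro x
  have h1 : (d k).rangeRestrict x = 0 ↔ d k x = 0 := by
    rw [← Subtype.coe_inj]; rfl
  rw [h1, hex k x]
  simp

lemma Ses.of_complex (P : ℤ → ModuleCat.{u} R) (d : ∀ i : ℤ, P (i + 1) →ₗ[R] P i)
    (hP : ∀ i, Module.Flat R (P i)) (hex : ∀ i : ℤ, Function.Exact (d (i + 1)) (d i))
    (ht : IsTensorExact R P d) (k : ℤ) :
    Ses R (LinearMap.range (d (k + 1))) (LinearMap.range (d k)) := by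
  refine ⟨P (k + 1), (LinearMap.range (d (k + 1))).subtype, (d k).rangeRestrict, hP _,
    Submodule.subtype_injective _, LinearMap.surjective_rangeRestrict _,
    range_exact P d hex k, ?_⟩
  intro I hI
  rw [← lTensor_inj_iff_lift, injective_iff_map_eq_zero]
  intro x hx
  obtain ⟨y, rfl⟩ := LinearMap.lTensor_surjective I
    (LinearMap.surjective_rangeRestrict (d (k + 1))) x
  rw [← LinearMap.comp_apply, ← LinearMap.lTensor_comp, LinearMap.subtype_comp_codRestrict] at hx
  obtain ⟨z, rfl⟩ := (ht I hI (k + 1) y).1 hx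
  rw [← LinearMap.comp_apply, ← LinearMap.lTensor_comp]
  have : (d (k + 1)).rangeRestrict.comp (d (k + 1 + 1)) = 0 := by
    ext a
    exact (hex (k + 1)).apply_apply_eq_zero a
  rw [this, LinearMap.lTensor_zero, LinearMap.zero_apply]

lemma Ses.build (S : ℤ → ModuleCat.{u} R) (h : ∀ i, Ses R (S (i + 1)) (S i)) :
    ∃ (P : ℤ → ModuleCat.{u} R) (d : ∀ i : ℤ, P (i + 1) →ₗ[R] P i),
      (∀ i, Module.Flat R (P i)) ∧ (∀ i : ℤ, Function.Exact (d (i + 1)) (d i)) ∧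
      IsTensorExact R P d ∧ ∀ i, Nonempty (S i ≃ₗ[R] LinearMap.range (d i)) := by
  have h1 : ∀ j, ∃ (Q : ModuleCat.{u} R) (f : S j →ₗ[R] Q), Module.Flat R Q ∧
      Function.Injective f ∧ (∀ (I : ModuleCat.{u} R), Module.Injective R I →
        Function.Injective (f.lTensor I)) ∧
      ∀ i, i + 1 = j → ∃ g : Q →ₗ[R] S i, Function.Surjective g ∧ Function.Exact f g := by
    intro j
    obtain ⟨i, rfl⟩ : ∃ i, i + 1 = j := ⟨j - 1, by omega⟩
    obtain ⟨Q, f, g, hQ, hf, hg, hex, hl⟩ := h i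
    refine ⟨Q, f, hQ, hf, fun I hI => (lTensor_inj_iff_lift f I).2 (hl I hI), ?_⟩
    intro i' hi'
    obtain rfl : i' = i := by omega
    exact ⟨g, hg, hex⟩
  choose Q f hQ hf hl hg using h1
  choose g hgs hge using fun i => hg (i + 1) i rfl
  have hex : ∀ i : ℤ, Function.Exact ((f (i + 1)).comp (g (i + 1))) ((f i).comp (g i)) := by
    intro i x
    have e1 : (f i).comp (g i) x = 0 ↔ g i x = 0 := by
      rw [LinearMap.comp_apply, map_eq_zero_iff _ (hf i)]
    rw [e1, hge i x]
    constructor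
    · rintro ⟨y, rfl⟩
      obtain ⟨z, rfl⟩ := hgs (i + 1) y
      exact ⟨z, rfl⟩
    · rintro ⟨z, rfl⟩
      exact ⟨_, rfl⟩
  refine ⟨Q, fun i => (f i).comp (g i), hQ, hex, ?_, ?_⟩
  · intro I hI i x
    rw [LinearMap.lTensor_comp, LinearMap.lTensor_comp]
    have e1 : ((f i).lTensor I).comp ((g i).lTensor I) x = 0 ↔ (g i).lTensor I x = 0 := by
      rw [LinearMap.comp_apply, map_eq_zero_iff _ (hl i I hI)]
    rw [e1, lTensor_exact I (hge i) (hgs i) x]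
    constructor
    · rintro ⟨y, rfl⟩
      obtain ⟨z, rfl⟩ := LinearMap.lTensor_surjective I (hgs (i + 1)) y
      exact ⟨z, rfl⟩
    · rintro ⟨z, rfl⟩
      exact ⟨_, rfl⟩
  · intro i
    have : LinearMap.range ((f i).comp (g i)) = LinearMap.range (f i) :=
      LinearMap.range_comp_of_range_eq_top _ (LinearMap.range_eq_top.2 (hgs i))
    exact ⟨(LinearEquiv.ofInjective (f i) (hf i)).trans (LinearEquiv.ofEq _ _ this.symm)⟩

lemma Ses.directSum {ι : Type} [DecidableEq ι] (A C : ι → ModuleCat.{u} R)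
    (h : ∀ i, Ses R (A i) (C i)) : Ses R (⨁ i, A i) (⨁ i, C i) := by
  choose Q f g hQ hf hg hex hl using h
  refine ⟨ModuleCat.of R (⨁ i, Q i), lmap f, lmap g,
    (inferInstance : Module.Flat R (⨁ i, Q i)), (lmap_injective f).2 hf,
    (lmap_surjective g).2 hg, ?_, ?_⟩
  · rw [LinearMap.exact_iff, ker_lmap, range_lmap]
    simp only [fun i => LinearMap.exact_iff.1 (hex i)]
  · intro I hI φ
    choose ψ hψ using fun i => hl i I hI (φ.comp (lof R ι (fun i => A i) i))
    refine ⟨toModule R ι _ ψ, ?_⟩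
    ext i a : 2
    have := LinearMap.congr_fun (hψ i) a
    simpa using this

lemma good_of_ses (S : ℤ → ModuleCat.{u} R) (h : ∀ i, Ses R (S (i + 1)) (S i)) (i : ℤ) :
    GoodMod R (S i) := by
  intro I hI j
  induction j generalizing i with
  | zero =>
    obtain ⟨Q, f, g, hQ, hf, hg, hex, hl⟩ := h i
    exact EV.of_lift f g hf hg hex (EV.of_flat 0 I) (hl I hI)
  | succ j ih =>
    obtain ⟨Q, f, g, hQ, hf, hg, hex, hl⟩ := h i
    exact EV.third f g hf hg hex (ih (i + 1)) (EV.of_flat _ I)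

lemma good_of_gflat (M : Type u) [AddCommGroup M] [Module R M] (h : IsGFlat R M) :
    GoodMod R M := by
  obtain ⟨P, d, hP, hex, ht, ⟨e⟩⟩ := h
  have := good_of_ses (fun i => ModuleCat.of R (LinearMap.range (d i)))
    (fun i => Ses.of_complex P d hP hex ht i) 0
  intro I hI j
  exact EV.retract e.toLinearMap e.symm.toLinearMap (by ext; simp) (this I hI j)

/-- Transport of images along an equality of indices. -/
def rangeCast (P : ℤ → ModuleCat.{u} R) (d : ∀ i : ℤ, P (i + 1) →ₗ[R] P i) {a b : ℤ}
    (h : a = b) : LinearMap.range (d a) ≃ₗ[R] LinearMap.range (d b) := by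
  subst h
  exact LinearEquiv.refl R _

end Helpers

/-- Over a coherent ring (every finitely generated ideal is finitely presented), `M` is
`n`-strongly Gorenstein flat iff there is an exact sequence
`0 → M → F_{n-1} → ⋯ → F_0 → M → 0` in which each `F i` has finite flat dimension,
such that the direct sum of the images is Gorenstein flat. -/
theorem nSGFlat_iff_syzygies_gFlat_of_coherent (R : Type u) [CommRing R]
    (hcoh : ∀ I : Ideal R, I.FG → Module.FinitePresentation R I)
    (n : ℕ) (hn : 0 < n) (M : Type u) [AddCommGroup M] [Module R M] :
    IsNSGFlat R n M ↔
      ∃ (P : ℤ → ModuleCat.{u} R) (d : ∀ i : ℤ, P (i + 1) →ₗ[R] P i),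
        (∀ i, ∃ m : ℕ, flatDimLE R m (P i)) ∧ IsPeriodicExact R n M P d ∧
        IsGFlat R (⨁ i : Fin n, LinearMap.range (d ((i : ℕ) : ℤ))) := by
  constructor
  · rintro ⟨P, d, hP, ⟨hex, hM⟩, ht⟩
    refine ⟨P, d, fun i => ⟨0, hP i⟩, ⟨hex, hM⟩, ?_⟩
    have hs := Ses.of_complex P d hP hex ht
    obtain ⟨P', d', hP', hex', ht', he⟩ := Ses.build
      (fun j => ModuleCat.of R (⨁ i : Fin n, LinearMap.range (d (((i : ℕ) : ℤ) + j))))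
      (fun j => Ses.directSum
        (fun i : Fin n => ModuleCat.of R (LinearMap.range (d (((i : ℕ) : ℤ) + (j + 1)))))
        (fun i : Fin n => ModuleCat.of R (LinearMap.range (d (((i : ℕ) : ℤ) + j))))
        (fun i => by
          exact (hs (((i : ℕ) : ℤ) + j)).congr (rangeCast P d (by ring)) (LinearEquiv.refl R _)))
    obtain ⟨e⟩ := he 0
    have e' : (⨁ i : Fin n, LinearMap.range (d ((i : ℕ) : ℤ))) ≃ₗ[R]
        ⨁ i : Fin n, LinearMap.range (d (((i : ℕ) : ℤ) + 0)) :=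
      DFinsupp.mapRange.linearEquiv fun i => rangeCast P d (by ring)
    exact ⟨P', d', hP', hex', ht', ⟨e'.trans e⟩⟩
  · rintro ⟨P, d, hP, ⟨hex, hM⟩, hG⟩
    have hgood := good_of_gflat _ hG
    obtain ⟨e0⟩ := hM 0
    obtain ⟨e1⟩ := hM 1
    rw [mul_zero] at e0
    rw [mul_one] at e1
    have hg1 : ∀ k : ℕ, k < n → GoodMod R (LinearMap.range (d (k : ℤ))) := by
      intro k hk I hI j
      exact EV.retract (lof R (Fin n) (fun i => LinearMap.range (d ((i : ℕ) : ℤ))) ⟨k, hk⟩)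
        (component R (Fin n) (fun i => LinearMap.range (d ((i : ℕ) : ℤ))) ⟨k, hk⟩)
        (LinearMap.ext fun x => component.lof_self (M := fun i : Fin n => LinearMap.range (d ((i : ℕ) : ℤ))) R ⟨k, hk⟩ x) (hgood I hI j)
    have hg2 : ∀ k : ℕ, k ≤ n → GoodMod R (LinearMap.range (d (k : ℤ))) := by
      intro k hk
      rcases hk.lt_or_eq with hk | rfl
      · exact hg1 k hk
      · intro I hI j
        have e := e1.symm.trans e0
        exact EV.retract e.toLinearMap e.symm.toLinearMap (by ext; simp)
          (hg1 0 hn I hI j)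
    have hs : ∀ k : ℕ, k < n →
        Ses R (LinearMap.range (d ((k : ℤ) + 1))) (LinearMap.range (d (k : ℤ))) := by
      intro k hk
      have hk1 : GoodMod R (LinearMap.range (d ((k : ℤ) + 1))) := by
        have := hg2 (k + 1) hk
        rwa [Nat.cast_add, Nat.cast_one] at this
      have hre := range_exact P d hex k
      have hgP : GoodMod R (P ((k : ℤ) + 1)) := fun I hI j =>
        EV.middle _ _ (Submodule.subtype_injective _) (LinearMap.surjective_rangeRestrict _)
          hre (hk1 I hI j) (hg1 k hk I hI j)
      exact ⟨P (k + 1), _, _, flat_of_good _ hgP (hP _), Submodule.subtype_injective _,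
        LinearMap.surjective_rangeRestrict _, hre, fun I hI =>
        EV.lift _ _ (Submodule.subtype_injective _) (LinearMap.surjective_rangeRestrict _)
          hre (hg1 k hk I hI 0)⟩
    have hn' : (0 : ℤ) < n := by exact_mod_cast hn
    obtain ⟨P', d', hP', hex', ht', he⟩ := Ses.build
      (fun j => ModuleCat.of R (LinearMap.range (d (j % n)))) (fun j => by
        have h0 := Int.emod_nonneg j hn'.ne'
        have h1 := Int.emod_lt_of_pos j hn'
        obtain ⟨k, hk⟩ := Int.eq_ofNat_of_zero_le h0
        have hkn : k < n := by omega
        have h2 := hs k hkn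
        rw [← hk] at h2
        by_cases hlast : j % n + 1 = n
        · have h3 : (j + 1) % n = 0 := by
            rw [← Int.emod_add_emod, hlast, Int.emod_self]
          exact h2.congr ((rangeCast P d h3).trans
            ((e0.symm.trans e1).trans (rangeCast P d hlast.symm))) (LinearEquiv.refl R _)
        · have h3 : (j + 1) % n = j % n + 1 := by
            rw [← Int.emod_add_emod]
            exact Int.emod_eq_of_lt (by omega) (by omega)
          exact h2.congr (rangeCast P d h3) (LinearEquiv.refl R _))
    refine ⟨P', d', hP', ⟨hex', fun k => ?_⟩, ht'⟩
    obtain ⟨e⟩ := he (n * k)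
    have : (n : ℤ) * k % n = 0 := Int.mul_emod_right _ _
    change (LinearMap.range (d ((n : ℤ) * k % n))) ≃ₗ[R] _ at e
    rw [this] at e
    exact ⟨e0.trans e⟩
end

section
/- Write M = M̃ ⊕ F, where F is flat and M̃ has no nonzero flat direct summands. Then M is n-strongly Gorenstein flat if and only if M̃ is n-strongly Gorenstein flat. -/
open CategoryTheory DirectSum

universe u

section Helpers

variable {R : Type u} [CommRing R]

/-- Every module embeds into an injective one. -/
lemma exists_embedding_injective (X : Type u) [AddCommGroup X] [Module R X] :
    ∃ (I : ModuleCat.{u} R) (f : X →ₗ[R] I), Module.Injective R I ∧ Function.Injective f := by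
  let J := Injective.under (ModuleCat.of R X)
  refine ⟨J, (Injective.ι (ModuleCat.of R X)).hom, ?_, ?_⟩
  · exact (Module.injective_iff_injective_object R J).mpr
      (inferInstanceAs (CategoryTheory.Injective (Injective.under (ModuleCat.of R X))))
  · exact (ModuleCat.mono_iff_injective _).mp inferInstance

/-- Kernel of a surjection of flat modules is flat. -/
lemma flat_of_exact_flat {K E B : Type u} [AddCommGroup K] [Module R K] [AddCommGroup E]
    [Module R E] [AddCommGroup B] [Module R B] [Module.Flat R E] [Module.Flat R B]
    (g : K →ₗ[R] E) (f : E →ₗ[R] B) (hg : Function.Injective g) (hf : Function.Surjective f)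
    (h : Function.Exact g f) : Module.Flat R K := by
  rw [Module.Flat.iff_rTensor_preserves_injective_linearMap]
  intro X Y _ _ _ _ s hs
  have h1 : Function.Injective (g.lTensor X) :=
    LinearMap.lTensor_injective_of_exact_of_flat f hf g hg h X
  have h2 : Function.Injective (s.rTensor E) :=
    Module.Flat.rTensor_preserves_injective_linearMap s hs
  have h3 : (g.lTensor Y) ∘ₗ (s.rTensor K) = (s.rTensor E) ∘ₗ (g.lTensor X) := by
    rw [LinearMap.lTensor_comp_rTensor, LinearMap.rTensor_comp_lTensor]
  have h4 : Function.Injective ((g.lTensor Y) ∘ₗ (s.rTensor K)) := by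
    rw [h3]; exact h2.comp h1
  exact Function.Injective.of_comp (f := g.lTensor Y) h4

/-- A quotient of flat modules is flat if the inclusion is injective after tensoring with
injective modules. -/
lemma flat_quotient {B P G : Type u} [AddCommGroup B] [Module R B] [AddCommGroup P]
    [Module R P] [AddCommGroup G] [Module R G] [Module.Flat R B] [Module.Flat R P]
    (g : B →ₗ[R] P) (f : P →ₗ[R] G) (hf : Function.Surjective f) (h : Function.Exact g f)
    (ht : ∀ (I : ModuleCat.{u} R), Module.Injective R I → Function.Injective (g.lTensor I)) :
    Module.Flat R G := by
  have pure : ∀ (X : Type u) [AddCommGroup X] [Module R X],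
      Function.Injective (g.lTensor X) := by
    intro X _ _
    obtain ⟨I, s, hI, hs⟩ := exists_embedding_injective (R := R) X
    have h2 : Function.Injective (s.rTensor B) :=
      Module.Flat.rTensor_preserves_injective_linearMap s hs
    have h3 : (g.lTensor I) ∘ₗ (s.rTensor B) = (s.rTensor P) ∘ₗ (g.lTensor X) := by
      rw [LinearMap.lTensor_comp_rTensor, LinearMap.rTensor_comp_lTensor]
    have h4 : Function.Injective ((s.rTensor P) ∘ₗ (g.lTensor X)) := by
      rw [← h3]; exact (ht I hI).comp h2
    exact Function.Injective.of_comp (f := s.rTensor P) h4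
  rw [Module.Flat.iff_lTensor_preserves_injective_linearMap]
  intro X Y _ _ _ _ s hs
  refine lTensor_injective_of_exact_of_exact_of_rTensor_injective
    (f₁ := g) (f₂ := f) (g₁ := s) (g₂ := (LinearMap.range s).mkQ) h hf
    (LinearMap.exact_map_mkQ_range s) (Submodule.mkQ_surjective _) ?_
    (Module.Flat.lTensor_preserves_injective_linearMap s hs)
  exact (LinearMap.lTensor_inj_iff_rTensor_inj _ _).mp (pure _)

lemma stage_a {A B P C : Type u} [AddCommGroup A] [Module R A] [AddCommGroup B] [Module R B]
    [AddCommGroup P] [Module R P] [AddCommGroup C] [Module R C]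
    [Module.Flat R B] [Module.Flat R P]
    (j : A × B →ₗ[R] P) (p : P →ₗ[R] C) (hj : Function.Injective j)
    (hp : Function.Surjective p) (h : Function.Exact j p)
    (ht : ∀ (I : ModuleCat.{u} R), Module.Injective R I → Function.Injective (j.lTensor I)) :
    ∃ (E : ModuleCat.{u} R) (ι : A →ₗ[R] E) (q : E →ₗ[R] C), Module.Flat R E ∧
      Function.Injective ι ∧ Function.Surjective q ∧ Function.Exact ι q ∧
      ∀ (I : ModuleCat.{u} R), Module.Injective R I → Function.Injective (ι.lTensor I) := by
  let g : B →ₗ[R] P := j ∘ₗ LinearMap.inr R A B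
  have hgp : LinearMap.range g ≤ LinearMap.ker p := by
    rintro _ ⟨b, rfl⟩
    exact (h _).mpr ⟨_, rfl⟩
  have hex : Function.Exact g (LinearMap.range g).mkQ := LinearMap.exact_map_mkQ_range g
  refine ⟨ModuleCat.of R (P ⧸ LinearMap.range g),
    (LinearMap.range g).mkQ ∘ₗ j ∘ₗ LinearMap.inl R A B,
    (LinearMap.range g).liftQ p hgp, ?_, ?_, ?_, ?_, ?_⟩
  · refine flat_quotient (R := R) g (LinearMap.range g).mkQ (Submodule.mkQ_surjective _) hex ?_
    intro I hI
    have h1 : Function.Injective ((LinearMap.inr R A B).lTensor I) := by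
      have : Function.LeftInverse ((LinearMap.snd R A B).lTensor I)
          ((LinearMap.inr R A B).lTensor I) := by
        intro x
        rw [← LinearMap.comp_apply, ← LinearMap.lTensor_comp, LinearMap.snd_comp_inr,
          LinearMap.lTensor_id]
        rfl
      exact this.injective
    rw [LinearMap.lTensor_comp]
    exact (ht I hI).comp h1
  · rw [injective_iff_map_eq_zero]
    intro a ha
    obtain ⟨b, hb⟩ := (hex _).mp ha
    have := hj hb
    exact (congrArg Prod.fst this).symm
  · intro c
    obtain ⟨x, rfl⟩ := hp c
    exact ⟨(LinearMap.range g).mkQ x, rfl⟩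
  · intro y
    obtain ⟨x, rfl⟩ := Submodule.mkQ_surjective _ y
    constructor
    · intro hx
      obtain ⟨⟨a, b⟩, rfl⟩ := (h x).mp hx
      refine ⟨a, ?_⟩
      have hb : (LinearMap.range g).mkQ (g b) = 0 := (hex _).mpr ⟨b, rfl⟩
      have : j (a, b) = j (a, 0) + g b := by
        change _ = _ + j (0, b)
        rw [← map_add]; simp
      rw [this, map_add, hb, add_zero]
      rfl
    · rintro ⟨a, ha⟩
      rw [← ha]
      exact (h _).mpr ⟨_, rfl⟩
  · intro I hI
    rw [injective_iff_map_eq_zero]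
    intro y hy
    rw [LinearMap.lTensor_comp, LinearMap.comp_apply] at hy
    obtain ⟨z, hz⟩ := (lTensor_exact I hex (Submodule.mkQ_surjective _) _).mp hy
    rw [LinearMap.lTensor_comp, LinearMap.lTensor_comp] at hz
    have h1 := ht I hI hz
    have h2 := congrArg ((LinearMap.fst R A B).lTensor I) h1
    rw [← LinearMap.comp_apply, ← LinearMap.comp_apply, ← LinearMap.lTensor_comp,
      ← LinearMap.lTensor_comp, LinearMap.fst_comp_inr, LinearMap.fst_comp_inl] at h2
    simpa using h2.symm

lemma stage_b {A E C D : Type u} [AddCommGroup A] [Module R A] [AddCommGroup E] [Module R E]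
    [AddCommGroup C] [Module R C] [AddCommGroup D] [Module R D]
    [Module.Flat R E] [Module.Flat R D]
    (ι : A →ₗ[R] E) (p : E →ₗ[R] C × D) (hι : Function.Injective ι)
    (hp : Function.Surjective p) (h : Function.Exact ι p)
    (ht : ∀ (I : ModuleCat.{u} R), Module.Injective R I → Function.Injective (ι.lTensor I)) :
    ∃ (E : ModuleCat.{u} R) (ι : A →ₗ[R] E) (q : E →ₗ[R] C), Module.Flat R E ∧
      Function.Injective ι ∧ Function.Surjective q ∧ Function.Exact ι q ∧
      ∀ (I : ModuleCat.{u} R), Module.Injective R I → Function.Injective (ι.lTensor I) := by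
  let s : E →ₗ[R] D := LinearMap.snd R C D ∘ₗ p
  have hk : ∀ a, ι a ∈ LinearMap.ker s := by
    intro a
    have : p (ι a) = 0 := (h _).mpr ⟨a, rfl⟩
    simp [s, this]
  refine ⟨ModuleCat.of R (LinearMap.ker s), ι.codRestrict _ hk,
    LinearMap.fst R C D ∘ₗ p ∘ₗ (LinearMap.ker s).subtype, ?_, ?_, ?_, ?_, ?_⟩
  · exact flat_of_exact_flat (LinearMap.ker s).subtype s Subtype.val_injective
      (Prod.snd_surjective.comp hp) (LinearMap.exact_subtype_ker_map s)
  · intro a b hab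
    exact hι (congrArg Subtype.val hab)
  · intro c
    obtain ⟨x, hx⟩ := hp (c, 0)
    exact ⟨⟨x, by simp [s, hx]⟩, by simp [hx]⟩
  · rintro ⟨x, hx⟩
    have hx' : (p x).2 = 0 := hx
    constructor
    · intro h0
      have h0' : (p x).1 = 0 := h0
      obtain ⟨a, ha⟩ := (h x).mp (Prod.ext h0' hx')
      exact ⟨a, Subtype.ext ha⟩
    · rintro ⟨a, ha⟩
      have : p x = 0 := (h x).mpr ⟨a, congrArg Subtype.val ha⟩
      change (p x).1 = 0
      rw [this]; rfl
  · intro I hI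
    have h1 := ht I hI
    have h2 : ι = (LinearMap.ker s).subtype ∘ₗ ι.codRestrict _ hk := rfl
    rw [h2, LinearMap.lTensor_comp] at h1
    exact Function.Injective.of_comp (f := (LinearMap.ker s).subtype.lTensor I) h1

lemma exact_glue {X Y Z W V : Type*} [AddCommGroup X] [Module R X] [AddCommGroup Y] [Module R Y]
    [AddCommGroup Z] [Module R Z] [AddCommGroup W] [Module R W] [AddCommGroup V] [Module R V]
    (s : X →ₗ[R] Y) (i : Y →ₗ[R] Z) (p : Z →ₗ[R] W) (m : W →ₗ[R] V)
    (hs : Function.Surjective s) (hm : Function.Injective m) (h : Function.Exact i p) :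
    Function.Exact (i ∘ₗ s) (m ∘ₗ p) :=
  hs.comp_exact_iff_exact.mpr (hm.comp_exact_iff_exact.mpr h)

/-- Transport along an index equality. -/
def castEquiv (A : ℤ → ModuleCat.{u} R) {i j : ℤ} (h : i = j) : A i ≃ₗ[R] A j :=
  h ▸ LinearEquiv.refl R (A i)

lemma assemble (n : ℕ) (N : Type u) [AddCommGroup N] [Module R N]
    (A E : ℤ → ModuleCat.{u} R) (ι : ∀ i, A (i + 1) →ₗ[R] E i) (π : ∀ i, E i →ₗ[R] A i)
    (hE : ∀ i, Module.Flat R (E i)) (hι : ∀ i, Function.Injective (ι i))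
    (hπ : ∀ i, Function.Surjective (π i)) (hex : ∀ i, Function.Exact (ι i) (π i))
    (ht : ∀ i, ∀ (I : ModuleCat.{u} R), Module.Injective R I →
      Function.Injective ((ι i).lTensor I))
    (hA : ∀ k : ℤ, Nonempty (N ≃ₗ[R] A ((n : ℤ) * k))) : IsNSGFlat R n N := by
  let c : ∀ i : ℤ, A (i + 1 - 1) ≃ₗ[R] A (i - 1 + 1) := fun i => castEquiv A (by ring)
  let s : ∀ i : ℤ, E (i + 1 - 1) →ₗ[R] A (i - 1 + 1) := fun i => (c i).toLinearMap ∘ₗ π (i + 1 - 1)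
  let m : ∀ i : ℤ, A (i + 1 - 1) →ₗ[R] E (i - 1) := fun i => ι (i - 1) ∘ₗ (c i).toLinearMap
  have hs : ∀ i, Function.Surjective (s i) := fun i => (c i).surjective.comp (hπ _)
  have hm : ∀ i, Function.Injective (m i) := fun i => (hι _).comp (c i).injective
  refine ⟨fun j => E (j - 1), fun i => ι (i - 1) ∘ₗ s i, fun i => hE _, ⟨?_, ?_⟩, ?_⟩
  · intro i
    exact exact_glue (s (i + 1)) (ι (i + 1 - 1)) (π (i + 1 - 1)) (m i) (hs _) (hm _) (hex _)
  · intro k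
    obtain ⟨e⟩ := hA k
    have hr : LinearMap.range (ι ((n : ℤ) * k - 1)) =
        LinearMap.range (ι ((n : ℤ) * k - 1) ∘ₗ s ((n : ℤ) * k)) := by
      rw [LinearMap.range_comp_of_range_eq_top _ (LinearMap.range_eq_top.mpr (hs _))]
    exact ⟨e ≪≫ₗ castEquiv A (by ring) ≪≫ₗ LinearEquiv.ofInjective _ (hι ((n : ℤ) * k - 1)) ≪≫ₗ
      LinearEquiv.ofEq _ _ hr⟩
  · intro I hI i
    have h1 : Function.Exact ((ι (i + 1 - 1)).lTensor I) ((π (i + 1 - 1)).lTensor I) :=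
      lTensor_exact I (hex _) (hπ _)
    have h2 : Function.Injective ((m i).lTensor I) := by
      simp only [m]
      rw [LinearMap.lTensor_comp]
      exact (ht _ I hI).comp (LinearEquiv.lTensor I (c i)).injective
    have h3 := exact_glue ((s (i + 1)).lTensor I) _ _ ((m i).lTensor I)
      (LinearMap.lTensor_surjective I (hs _)) h2 h1
    rw [← LinearMap.lTensor_comp, ← LinearMap.lTensor_comp] at h3
    exact h3

lemma range_lTensor_injective {X Y Z : Type u} [AddCommGroup X] [Module R X] [AddCommGroup Y]
    [Module R Y] [AddCommGroup Z] [Module R Z] (f : X →ₗ[R] Y) (g : Y →ₗ[R] Z)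
    (h : Function.Exact f g) (I : Type u) [AddCommGroup I] [Module R I]
    (ht : Function.Exact (f.lTensor I) (g.lTensor I)) :
    Function.Injective ((LinearMap.range g).subtype.lTensor I) := by
  rw [injective_iff_map_eq_zero]
  intro y hy
  obtain ⟨x, rfl⟩ := LinearMap.lTensor_surjective I g.surjective_rangeRestrict y
  rw [← LinearMap.comp_apply, ← LinearMap.lTensor_comp] at hy
  obtain ⟨z, rfl⟩ := (ht x).mp hy
  have : g.rangeRestrict ∘ₗ f = 0 := by
    ext a
    exact (h _).mpr ⟨a, rfl⟩
  rw [← LinearMap.comp_apply, ← LinearMap.lTensor_comp, this]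
  simp

lemma prodMap_lTensor_injective {X Y Z W : Type u} [AddCommGroup X] [Module R X] [AddCommGroup Y]
    [Module R Y] [AddCommGroup Z] [Module R Z] [AddCommGroup W] [Module R W]
    (f : X →ₗ[R] Y) (g : Z →ₗ[R] W) (I : Type u) [AddCommGroup I] [Module R I]
    (hf : Function.Injective (f.lTensor I)) (hg : Function.Injective (g.lTensor I)) :
    Function.Injective ((f.prodMap g).lTensor I) := by
  rw [injective_iff_map_eq_zero]
  intro y hy
  have h1 : (LinearMap.fst R X Z).lTensor I y = 0 := by
    apply hf
    have := congrArg ((LinearMap.fst R Y W).lTensor I) hy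
    rw [← LinearMap.comp_apply, ← LinearMap.lTensor_comp] at this ⊢
    rw [map_zero] at this ⊢
    exact this
  have h2 : (LinearMap.snd R X Z).lTensor I y = 0 := by
    apply hg
    have := congrArg ((LinearMap.snd R Y W).lTensor I) hy
    rw [← LinearMap.comp_apply, ← LinearMap.lTensor_comp] at this ⊢
    rw [map_zero] at this ⊢
    exact this
  have h3 : (LinearMap.inl R X Z ∘ₗ LinearMap.fst R X Z + LinearMap.inr R X Z ∘ₗ
      LinearMap.snd R X Z) = LinearMap.id := by
    ext <;> simp
  have h4 : LinearMap.lTensor I (LinearMap.id : X × Z →ₗ[R] X × Z) y = y := by simp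
  rw [← h4, ← h3, LinearMap.lTensor_add, LinearMap.lTensor_comp, LinearMap.lTensor_comp]
  simp [h1, h2]

lemma flat_prod (X Y : Type u) [AddCommGroup X] [Module R X] [AddCommGroup Y] [Module R Y]
    [Module.Flat R X] [Module.Flat R Y] : Module.Flat R (X × Y) := by
  rw [Module.Flat.iff_rTensor_preserves_injective_linearMap]
  intro V W _ _ _ _ s hs
  have h1 : Function.Injective (s.rTensor X) :=
    Module.Flat.rTensor_preserves_injective_linearMap s hs
  have h2 : Function.Injective (s.rTensor Y) :=
    Module.Flat.rTensor_preserves_injective_linearMap s hs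
  rw [injective_iff_map_eq_zero]
  intro y hy
  have h3 : (LinearMap.fst R X Y).lTensor V y = 0 := by
    apply h1
    have := congrArg ((LinearMap.fst R X Y).lTensor W) hy
    rw [← LinearMap.comp_apply, LinearMap.lTensor_comp_rTensor, map_zero] at this
    rw [← LinearMap.comp_apply, LinearMap.rTensor_comp_lTensor, map_zero]
    exact this
  have h4 : (LinearMap.snd R X Y).lTensor V y = 0 := by
    apply h2
    have := congrArg ((LinearMap.snd R X Y).lTensor W) hy
    rw [← LinearMap.comp_apply, LinearMap.lTensor_comp_rTensor, map_zero] at this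
    rw [← LinearMap.comp_apply, LinearMap.rTensor_comp_lTensor, map_zero]
    exact this
  have h5 : (LinearMap.inl R X Y ∘ₗ LinearMap.fst R X Y + LinearMap.inr R X Y ∘ₗ
      LinearMap.snd R X Y) = LinearMap.id := by
    ext <;> simp
  have h6 : LinearMap.lTensor V (LinearMap.id : X × Y →ₗ[R] X × Y) y = y := by simp
  rw [← h6, ← h5, LinearMap.lTensor_add, LinearMap.lTensor_comp, LinearMap.lTensor_comp]
  simp [h3, h4]

end Helpers

/-- If `M = M̃ ⊕ F` with `F` flat and `M̃` having no nonzero flat direct summands, then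
`M` is `n`-strongly Gorenstein flat iff so is `M̃`. -/
theorem nSGFlat_iff_reduced_part (R : Type u) [CommRing R] (n : ℕ) (hn : 0 < n)
    (M N F : Type u) [AddCommGroup M] [Module R M] [AddCommGroup N] [Module R N]
    [AddCommGroup F] [Module R F]
    (e : M ≃ₗ[R] N × F) (hF : Module.Flat R F)
    (hN : ∀ Q : Submodule R N, (∃ Q' : Submodule R N, IsCompl Q Q') →
      Module.Flat R Q → Q = ⊥) :
    IsNSGFlat R n M ↔ IsNSGFlat R n N := by
  constructor
  · rintro ⟨P, d, hP, ⟨hex, hM⟩, hT⟩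
    have key : ∀ i : ℤ, ∃ (A B : ModuleCat.{u} R), Module.Flat R B ∧
        Nonempty ((A × B) ≃ₗ[R] LinearMap.range (d i)) ∧
        ∀ k : ℤ, i = (n : ℤ) * k → Nonempty (N ≃ₗ[R] A) := by
      intro i
      by_cases hi : ∃ k : ℤ, i = (n : ℤ) * k
      · obtain ⟨k, rfl⟩ := hi
        obtain ⟨f⟩ := hM k
        exact ⟨ModuleCat.of R N, ModuleCat.of R F, hF, ⟨e.symm ≪≫ₗ f⟩,
          fun _ _ => ⟨LinearEquiv.refl R N⟩⟩
      · refine ⟨ModuleCat.of R (LinearMap.range (d i)), ModuleCat.of R PUnit.{u + 1}, ?_, ?_, ?_⟩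
        · exact inferInstanceAs (Module.Flat R PUnit.{u + 1})
        · exact ⟨LinearEquiv.prodUnique (R := R) (M := LinearMap.range (d i)) (M₂ := PUnit.{u + 1})⟩
        · intro k hk
          exact absurd ⟨k, hk⟩ hi
    choose A B hB hAB hA using key
    have ses : ∀ i : ℤ, ∃ (E : ModuleCat.{u} R) (ι : A (i + 1) →ₗ[R] E) (q : E →ₗ[R] A i),
        Module.Flat R E ∧ Function.Injective ι ∧ Function.Surjective q ∧ Function.Exact ι q ∧
        ∀ (I : ModuleCat.{u} R), Module.Injective R I → Function.Injective (ι.lTensor I) := by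
      intro i
      obtain ⟨e1⟩ := hAB (i + 1)
      obtain ⟨e0⟩ := hAB i
      have := hP (i + 1)
      have := hB (i + 1)
      have := hB i
      obtain ⟨E, ι, q, h1, h2, h3, h4, h5⟩ := stage_a (R := R)
        ((LinearMap.range (d (i + 1))).subtype ∘ₗ e1.toLinearMap)
        (e0.symm.toLinearMap ∘ₗ (d i).rangeRestrict)
        (Subtype.val_injective.comp e1.injective)
        (e0.symm.surjective.comp (d i).surjective_rangeRestrict)
        (by
          refine exact_glue _ _ _ _ e1.surjective e0.symm.injective ?_
          intro x
          rw [← LinearMap.mem_ker, LinearMap.ker_rangeRestrict, LinearMap.mem_ker, hex i x]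
          simp)
        (by
          intro I hI
          rw [LinearMap.lTensor_comp]
          exact (range_lTensor_injective _ _ (hex (i + 1)) I (hT I hI (i + 1))).comp
            (LinearEquiv.lTensor I e1).injective)
      exact stage_b (R := R) ι q h2 h3 h4 h5
    choose E ι π h1 h2 h3 h4 h5 using ses
    exact assemble n N A E ι π h1 h2 h3 h4 h5 (fun k => hA _ k rfl)
  · rintro ⟨P, d, hP, ⟨hex, hM⟩, hT⟩
    refine assemble n M (fun i => ModuleCat.of R (LinearMap.range (d i) × F))
      (fun i => ModuleCat.of R (P (i + 1) × (F × F)))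
      (fun i => (LinearMap.range (d (i + 1))).subtype.prodMap (LinearMap.inl R F F))
      (fun i => (d i).rangeRestrict.prodMap (LinearMap.snd R F F)) ?_ ?_ ?_ ?_ ?_ ?_
    · intro i
      have := hP (i + 1)
      have := flat_prod (R := R) F F
      exact flat_prod (R := R) (P (i + 1)) (F × F)
    · intro i
      exact Function.Injective.prodMap Subtype.val_injective LinearMap.inl_injective
    · intro i
      exact Function.Surjective.prodMap (d i).surjective_rangeRestrict Prod.snd_surjective
    · rintro i ⟨x, a, b⟩
      constructor
      · intro h
        have hx : d i x = 0 := congrArg (fun t => (t.1 : P i)) h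
        have hb : b = 0 := congrArg Prod.snd h
        subst hb
        exact ⟨(⟨x, (hex i x).mp hx⟩, a), rfl⟩
      · rintro ⟨⟨⟨y, hy⟩, c⟩, h⟩
        have hx : y = x := congrArg Prod.fst h
        have hb : 0 = b := congrArg (fun t => t.2.2) h
        subst hx hb
        exact Prod.ext (Subtype.ext ((hex i y).mpr hy)) rfl
    · intro i I hI
      refine prodMap_lTensor_injective _ _ I
        (range_lTensor_injective _ _ (hex (i + 1)) I (hT I hI (i + 1))) ?_
      have : Function.LeftInverse ((LinearMap.fst R F F).lTensor I)
          ((LinearMap.inl R F F).lTensor I) := by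
        intro x
        rw [← LinearMap.comp_apply, ← LinearMap.lTensor_comp, LinearMap.fst_comp_inl,
          LinearMap.lTensor_id]
        rfl
      exact this.injective
    · intro k
      obtain ⟨f⟩ := hM k
      exact ⟨e ≪≫ₗ LinearEquiv.prodCongr f (LinearEquiv.refl R F)⟩
end

section
/- Every finitely generated n-strongly Gorenstein projective module is finitely presented and n-strongly Gorenstein flat. -/
open CategoryTheory DirectSum

universe u

section Helpers

variable {R : Type u} [CommRing R]

lemma aux_finite_free {P : Type u} [AddCommGroup P] [Module R P] [Module.Projective R P]
    (N : Submodule R P) (hN : N.FG) :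
    ∃ (ι : Type u) (_ : Fintype ι) (a : P →ₗ[R] (ι → R)) (b : (ι → R) →ₗ[R] P),
      ∀ x ∈ N, b (a x) = x := by
  classical
  obtain ⟨s, hs⟩ := (Module.projective_def' (R := R) (P := P)).1 inferInstance
  obtain ⟨S, rfl⟩ := hN
  let T : Finset P := S.biUnion fun x => (s x).support
  refine ⟨T, inferInstance, LinearMap.pi fun t => (Finsupp.lapply t.1) ∘ₗ s,
    Fintype.linearCombination R (fun t : T => t.1), ?_⟩
  intro x hx
  have key : Set.EqOn ((Fintype.linearCombination R (fun t : T => t.1)) ∘ₗ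
      (LinearMap.pi fun t : T => (Finsupp.lapply t.1) ∘ₗ s)) (LinearMap.id : P →ₗ[R] P) S := by
    intro y hy
    have h1 : Finsupp.linearCombination R id (s y) = y := LinearMap.congr_fun hs y
    have h2 : (s y).support ⊆ T := Finset.subset_biUnion_of_mem (fun x => (s x).support) hy
    rw [Finsupp.linearCombination_apply, Finsupp.sum_of_support_subset _ h2 _ (by simp)] at h1
    simp only [LinearMap.comp_apply, Fintype.linearCombination_apply, LinearMap.pi_apply,
      Finsupp.lapply_apply, LinearMap.id_apply]
    rw [← Finset.sum_coe_sort T] at h1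
    exact h1
  exact LinearMap.eqOn_span key hx

/-- stably finite: identity factors as sum through a finite and a projective module -/
def StFin (R : Type u) [CommRing R] (Z : Type u) [AddCommGroup Z] [Module R Z] : Prop :=
  ∃ (G Q : ModuleCat.{u} R) (f : Z →ₗ[R] G) (g : G →ₗ[R] Z) (p : Z →ₗ[R] Q) (v : Q →ₗ[R] Z),
    Module.Finite R G ∧ Module.Projective R Q ∧ ∀ z, g (f z) + v (p z) = z

def StFP (R : Type u) [CommRing R] (Z : Type u) [AddCommGroup Z] [Module R Z] : Prop :=
  ∃ (G Q : ModuleCat.{u} R) (f : Z →ₗ[R] G) (g : G →ₗ[R] Z) (p : Z →ₗ[R] Q) (v : Q →ₗ[R] Z),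
    Module.FinitePresentation R G ∧ Module.Projective R Q ∧ ∀ z, g (f z) + v (p z) = z

lemma StFP.stFin {Z : Type u} [AddCommGroup Z] [Module R Z] (h : StFP R Z) : StFin R Z := by
  obtain ⟨G, Q, f, g, p, v, h1, h2, h3⟩ := h
  exact ⟨G, Q, f, g, p, v, inferInstance, h2, h3⟩

lemma StFin.of_finite {Z : Type u} [AddCommGroup Z] [Module R Z] [Module.Finite R Z] :
    StFin R Z :=
  ⟨ModuleCat.of R Z, ModuleCat.of R R, LinearMap.id, LinearMap.id, 0, 0, 
    inferInstanceAs (Module.Finite R Z), inferInstanceAs (Module.Projective R R), fun z => by simp⟩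

lemma StFin.step {Z P Z' : Type u} [AddCommGroup Z] [Module R Z] [AddCommGroup P] [Module R P]
    [AddCommGroup Z'] [Module R Z'] [Module.Projective R P] (i : Z →ₗ[R] P) (π : P →ₗ[R] Z')
    (hπ : Function.Surjective π) (hex : Function.Exact i π)
    (hext : ∀ Q : ModuleCat.{u} R, Module.Projective R Q → ∀ φ : Z →ₗ[R] Q,
      ∃ ψ : P →ₗ[R] Q, ∀ z, ψ (i z) = φ z)
    (hZ : StFin R Z) : StFP R Z' := by
  obtain ⟨G, Q, f, g, p, v, hG, hQ, h⟩ := hZ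
  obtain ⟨ι, _, a, b, hab⟩ := aux_finite_free (LinearMap.range (i ∘ₗ g))
    (by rw [← Submodule.map_top]; exact Module.Finite.fg_top.map _)
  obtain ⟨h', hh'⟩ := hext (ModuleCat.of R (ι → R))
    (inferInstanceAs (Module.Projective R (ι → R))) (a ∘ₗ i ∘ₗ g ∘ₗ f)
  obtain ⟨p', hp'⟩ := hext Q hQ p
  replace hh' : ∀ z, h' (i z) = a (i (g (f z))) := hh'
  have hab' : ∀ y, b (a (i (g y))) = i (g y) := fun y => hab _ ⟨y, rfl⟩
  let W : Submodule R (ι → R) := LinearMap.range (a ∘ₗ i ∘ₗ g)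
  have hW : W.FG := by
    rw [show W = _ from (Submodule.map_top (a ∘ₗ i ∘ₗ g)).symm]; exact Module.Finite.fg_top.map _
  -- descend maps along `π`
  have desc : ∀ {X : Type u} [AddCommGroup X] [Module R X] (t : P →ₗ[R] X),
      (∀ z, t (i z) = 0) → ∃ t' : Z' →ₗ[R] X, ∀ x, t' (π x) = t x := by
    intro X _ _ t ht
    have hk : LinearMap.ker π ≤ LinearMap.ker t := by
      intro x hx
      obtain ⟨z, rfl⟩ := (hex x).1 hx
      exact ht z
    refine ⟨(LinearMap.ker π).liftQ t hk ∘ₗ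
      (π.quotKerEquivOfSurjective hπ).symm.toLinearMap, fun x => ?_⟩
    have : (π.quotKerEquivOfSurjective hπ).symm (π x) = Submodule.Quotient.mk x := by
      rw [LinearEquiv.symm_apply_eq]; rfl
    simp [this]
  have hπi : ∀ z, π (i z) = 0 := fun z => (hex _).2 ⟨z, rfl⟩
  obtain ⟨f', hf'⟩ := desc (W.mkQ ∘ₗ h') (fun z => by
    simp only [LinearMap.comp_apply, Submodule.mkQ_apply, Submodule.Quotient.mk_eq_zero]
    rw [hh']; exact ⟨f z, rfl⟩)
  let g' : ((ι → R) ⧸ W) →ₗ[R] Z' := W.liftQ (π ∘ₗ b) (by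
    rintro _ ⟨y, rfl⟩
    simp [hab', hπi])
  obtain ⟨t, ht⟩ := desc (LinearMap.id - b ∘ₗ h' - i ∘ₗ v ∘ₗ p') (fun z => by
    simp only [LinearMap.sub_apply, LinearMap.comp_apply, LinearMap.id_apply, hh', hab', hp']
    nth_rewrite 1 [← h z]
    simp)
  refine ⟨ModuleCat.of R ((ι → R) ⧸ W), ModuleCat.of R P, f', g', t, π, ?_,
    inferInstanceAs (Module.Projective R P), ?_⟩
  · exact Module.finitePresentation_of_surjective W.mkQ W.mkQ_surjective (by simpa using hW)
  · intro z
    obtain ⟨x, rfl⟩ := hπ z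
    have e1 : g' (f' (π x)) = π (b (h' x)) := by rw [hf']; rfl
    have e2 : π (t (π x)) = π x - π (b (h' x)) := by
      rw [ht]; simp [hπi]
    erw [e1, e2]
    abel

lemma StFP.finitePresentation {Z : Type u} [AddCommGroup Z] [Module R Z] [Module.Finite R Z]
    (h : StFP R Z) : Module.FinitePresentation R Z := by
  obtain ⟨G, Q, f, g, p, v, hG, hQ, h⟩ := h
  obtain ⟨ι, _, a, b, hab⟩ := aux_finite_free (LinearMap.range p)
    (by rw [← Submodule.map_top]; exact Module.Finite.fg_top.map _)
  let s : Z →ₗ[R] G × (ι → R) := f.prod (a ∘ₗ p)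
  let r : G × (ι → R) →ₗ[R] Z := g.coprod (v ∘ₗ b)
  have hrs : r ∘ₗ s = LinearMap.id := by
    ext z
    simp only [s, r, LinearMap.comp_apply, LinearMap.prod_apply, Function.prod_apply,
      LinearMap.coprod_apply, LinearMap.id_apply]
    rw [hab _ ⟨z, rfl⟩, h]
  have hrs' : ∀ z, r (s z) = z := fun z => LinearMap.congr_fun hrs z
  refine Module.finitePresentation_of_surjective r (fun z => ⟨s z, hrs' z⟩) ?_
  have : LinearMap.ker r = Submodule.map (LinearMap.id - s ∘ₗ r) ⊤ := by
    ext x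
    simp only [LinearMap.mem_ker, Submodule.mem_map, Submodule.mem_top, true_and,
      LinearMap.sub_apply, LinearMap.id_apply, LinearMap.comp_apply]
    constructor
    · intro hx
      exact ⟨x, by simp [hx]⟩
    · rintro ⟨y, rfl⟩
      rw [map_sub, hrs', sub_self]
  rw [this]
  exact Module.Finite.fg_top.map _

/-- elements of `I ⊗ Z` are detected by functionals on `Z` -/
def Tight (I : Type u) (Z : Type*) [AddCommGroup I] [Module R I] [AddCommGroup Z] [Module R Z] : Prop :=
  ∀ x : TensorProduct R I Z, (∀ φ : Z →ₗ[R] R, LinearMap.lTensor I φ x = 0) → x = 0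

lemma tight_pi (I : Type u) [AddCommGroup I] [Module R I] (ι : Type*) [Fintype ι] :
    Tight (R := R) I (ι → R) := by
  classical
  intro x hx
  apply (TensorProduct.piScalarRight R R I ι).injective
  rw [map_zero]
  ext j
  have : ∀ x : TensorProduct R I (ι → R), TensorProduct.piScalarRight R R I ι x j =
      TensorProduct.rid R I (LinearMap.lTensor I (LinearMap.proj j) x) := by
    intro x
    induction x with
    | zero => simp
    | add x y hx hy => simp only [map_add, Pi.add_apply, hx, hy]
    | tmul a b => simp
  rw [this, hx]; simp

lemma tight_of_fp (I : Type u) [AddCommGroup I] [Module R I] [Module.Injective R I]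
    (G : Type u) [AddCommGroup G] [Module R G] [Module.FinitePresentation R G] :
    Tight (R := R) I G := by
  classical
  intro x hx
  obtain ⟨n, m, f, g, hf, hfg⟩ := Module.FinitePresentation.exists_fin' R G
  obtain ⟨y, rfl⟩ := LinearMap.lTensor_surjective I hf x
  have ltc : ∀ {A B C : Type u} [AddCommGroup A] [AddCommGroup B] [AddCommGroup C] [Module R A]
      [Module R B] [Module R C] (q : B →ₗ[R] C) (p : A →ₗ[R] B) (w : TensorProduct R I A),
      LinearMap.lTensor I q (LinearMap.lTensor I p w) = LinearMap.lTensor I (q ∘ₗ p) w :=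
    fun q p w => (LinearMap.lTensor_comp_apply I q p w).symm
  let ev : ((Fin n → R) →ₗ[R] R) →ₗ[R] I :=
    { toFun := fun φ => TensorProduct.rid R I (LinearMap.lTensor I φ y)
      map_add' := fun a b => by simp [LinearMap.lTensor_add]
      map_smul' := fun a b => by simp [LinearMap.lTensor_smul] }
  let gd : ((Fin n → R) →ₗ[R] R) →ₗ[R] ((Fin m → R) →ₗ[R] R) := LinearMap.lcomp R R g
  have hker : LinearMap.ker gd ≤ LinearMap.ker ev := by
    intro φ hφ
    have hφ' : ∀ w, φ (g w) = 0 := fun w => LinearMap.congr_fun (LinearMap.mem_ker.1 hφ) w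
    have hk : LinearMap.ker f ≤ LinearMap.ker φ := by
      intro w hw
      obtain ⟨z, rfl⟩ := (hfg w).1 hw
      exact hφ' z
    let φ' : G →ₗ[R] R := (LinearMap.ker f).liftQ φ hk ∘ₗ
      (f.quotKerEquivOfSurjective hf).symm.toLinearMap
    have h1 : φ' ∘ₗ f = φ := by
      ext1 w
      have : (f.quotKerEquivOfSurjective hf).symm (f (Pi.single w 1)) =
          Submodule.Quotient.mk (Pi.single w 1) := by
        rw [LinearEquiv.symm_apply_eq]; rfl
      ext
      simp [φ', this]
    have h2 := hx φ'
    rw [ltc, h1] at h2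
    simp [ev, h2]
  obtain ⟨ψ, hψ⟩ := Module.Injective.out ((LinearMap.ker gd).liftQ gd le_rfl)
    (by rw [← LinearMap.ker_eq_bot]; exact Submodule.ker_liftQ_eq_bot _ _ _ le_rfl)
    ((LinearMap.ker gd).liftQ ev hker)
  have hψ' : ∀ φ, ψ (φ ∘ₗ g) = TensorProduct.rid R I (LinearMap.lTensor I φ y) :=
    fun φ => hψ (Submodule.Quotient.mk φ)
  let z : TensorProduct R I (Fin m → R) := ∑ j, TensorProduct.tmul R
    (ψ (LinearMap.proj j)) (Pi.single j 1)
  have hz : ∀ χ : (Fin m → R) →ₗ[R] R, TensorProduct.rid R I (LinearMap.lTensor I χ z) = ψ χ := by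
    intro χ
    have : χ = ∑ j, χ (Pi.single j 1) • (LinearMap.proj j : (Fin m → R) →ₗ[R] R) := by
      ext j
      simp [Pi.single_apply]
    conv_rhs => rw [this]
    simp [z]
  have hy : y = LinearMap.lTensor I g z := by
    rw [← sub_eq_zero]
    apply tight_pi
    intro φ
    apply (TensorProduct.rid R I).injective
    rw [map_sub, map_sub, ltc, hz, hψ', sub_self, map_zero]
  rw [hy]
  exact (lTensor_exact I hfg hf).apply_apply_eq_zero z

lemma tight_of_projective (I : Type u) [AddCommGroup I] [Module R I]
    (Q : Type u) [AddCommGroup Q] [Module R Q] [Module.Projective R Q] :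
    Tight (R := R) I Q := by
  intro x hx
  obtain ⟨N, hN, hxN⟩ := TensorProduct.exists_finite_submodule_right_of_setFinite {x}
    (Set.finite_singleton x)
  obtain ⟨w, hw⟩ := hxN rfl
  obtain ⟨ι, _, a, b, hab⟩ := aux_finite_free N (Module.Finite.iff_fg.1 hN)
  have h1 : LinearMap.lTensor I a x = 0 := by
    apply tight_pi
    intro φ
    rw [← LinearMap.lTensor_comp_apply]
    exact hx _
  have h2 : (b ∘ₗ a) ∘ₗ N.subtype = N.subtype := by
    ext s
    exact hab s s.2
  rw [← hw, ← h2, LinearMap.lTensor_comp_apply, hw, LinearMap.lTensor_comp_apply, h1, map_zero]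

lemma StFP.tight (I : Type u) [AddCommGroup I] [Module R I] [Module.Injective R I]
    (Z : Type u) [AddCommGroup Z] [Module R Z] (h : StFP R Z) : Tight (R := R) I Z := by
  obtain ⟨G, Q, f, g, p, v, hG, hQ, h⟩ := h
  intro x hx
  have h1 : LinearMap.lTensor I f x = 0 := by
    apply tight_of_fp
    intro φ
    rw [← LinearMap.lTensor_comp_apply]
    exact hx _
  have h2 : LinearMap.lTensor I p x = 0 := by
    apply tight_of_projective
    intro φ
    rw [← LinearMap.lTensor_comp_apply]
    exact hx _
  have h3 : g ∘ₗ f + v ∘ₗ p = LinearMap.id := LinearMap.ext h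
  have h4 : LinearMap.lTensor I (g ∘ₗ f + v ∘ₗ p) x = x := by rw [h3, LinearMap.lTensor_id_apply]
  rw [LinearMap.lTensor_add, LinearMap.add_apply, LinearMap.lTensor_comp_apply,
    LinearMap.lTensor_comp_apply, h1, h2, map_zero, map_zero, add_zero] at h4
  exact h4.symm

end Helpers

/-- Every finitely generated `n`-strongly Gorenstein projective module is finitely
presented and `n`-strongly Gorenstein flat. -/
theorem nSGFlat_of_fg_nSGProjective (R : Type u) [CommRing R] (n : ℕ) (hn : 0 < n)
    (M : Type u) [AddCommGroup M] [Module R M] [Module.Finite R M]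
    (hM : IsNSGProjective R n M) :
    Module.FinitePresentation R M ∧ IsNSGFlat R n M := by 
  obtain ⟨P, d, hP, ⟨hex, hper⟩, hhom⟩ := hM
  have hext : ∀ (i : ℤ) (Q : ModuleCat.{u} R), Module.Projective R Q →
      ∀ φ : LinearMap.range (d i) →ₗ[R] Q,
      ∃ ψ : P i →ₗ[R] Q, ∀ z, ψ ((LinearMap.range (d i)).subtype z) = φ z := by
    intro i Q hQ φ
    have h0 : (φ ∘ₗ (d i).rangeRestrict).comp (d (i + 1)) = 0 := by
      ext w
      have : (d i).rangeRestrict (d (i + 1) w) = 0 :=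
        Subtype.ext ((hex i).apply_apply_eq_zero w)
      simp only [LinearMap.comp_apply, this, map_zero, LinearMap.zero_apply]
    obtain ⟨ψ, hψ⟩ := (hhom Q hQ i _).1 h0
    refine ⟨ψ, ?_⟩
    rintro ⟨_, w, rfl⟩
    exact LinearMap.congr_fun hψ w
  have hexr : ∀ i : ℤ, Function.Exact (d (i + 1)) (d i).rangeRestrict := by
    intro i w
    rw [← hex i w]
    exact Subtype.ext_iff
  have step : ∀ i : ℤ, StFin R (LinearMap.range (d (i + 1))) →
      StFP R (LinearMap.range (d i)) := by
    intro i h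
    have := hP (i + 1)
    refine StFin.step (LinearMap.range (d (i + 1))).subtype (d i).rangeRestrict
      (d i).surjective_rangeRestrict ?_ (hext (i + 1)) h
    intro w
    rw [hexr i w]
    simp
  have down : ∀ (m : ℕ) (i : ℤ), StFin R (LinearMap.range (d (i + 1 + m))) →
      StFP R (LinearMap.range (d i)) := by
    intro m
    induction m with
    | zero =>
      intro i h
      rw [Nat.cast_zero, add_zero] at h
      exact step i h
    | succ m ih =>
      intro i h
      apply step
      apply StFP.stFin
      apply ih
      rw [show i + 1 + 1 + (m : ℤ) = i + 1 + ((m + 1 : ℕ) : ℤ) by push_cast; ring]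
      exact h
  have good : ∀ i : ℤ, StFP R (LinearMap.range (d i)) := by
    intro i
    obtain ⟨e⟩ := hper (|i| + 1)
    have hle : i + 1 ≤ (n : ℤ) * (|i| + 1) := by
      have h1 : (1 : ℤ) ≤ n := by exact_mod_cast hn
      nlinarith [le_abs_self i, abs_nonneg i]
    obtain ⟨m, hm⟩ := Int.le.dest hle
    apply down m
    rw [hm]
    have := Module.Finite.equiv e
    exact StFin.of_finite
  constructor
  · obtain ⟨e⟩ := hper 0
    have := Module.Finite.equiv e
    have := (good (n * 0)).finitePresentation
    exact Module.FinitePresentation.of_equiv e.symm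
  · refine ⟨P, d, fun i => ?_, ⟨hex, hper⟩, ?_⟩
    · have := hP i
      infer_instance
    · intro I hI i
      have hinj : Function.Injective
          (LinearMap.lTensor I (LinearMap.range (d i)).subtype) := by
        rw [injective_iff_map_eq_zero]
        intro x hx
        refine StFP.tight I _ (good i) x ?_
        intro φ
        obtain ⟨ψ, hψ⟩ := hext i (ModuleCat.of R R)
          (inferInstanceAs (Module.Projective R R)) φ
        have h1 : ψ ∘ₗ (LinearMap.range (d i)).subtype = φ := LinearMap.ext hψ
        have h2 := LinearMap.lTensor_comp_apply I ψ (LinearMap.range (d i)).subtype x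
        rw [h1, hx, map_zero] at h2
        exact h2
      have h3 := lTensor_exact I (hexr i) (d i).surjective_rangeRestrict
      have h4 : d i = (LinearMap.range (d i)).subtype ∘ₗ (d i).rangeRestrict := rfl
      intro w
      rw [← h3 w]
      conv_lhs => rw [h4, LinearMap.lTensor_comp_apply]
      exact map_eq_zero_iff _ hinj
end
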